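/- For k = 0, 1, 2 let θ_k = 2kπ/3, u_k = (sin θ_k, −cos θ_k), and let ν_k be the Borel measure on Γ = (ℝ/2πℤ) × ℝ given by ν_k = (1/2)(f_k)_*(ℒ) + (1/2)(g_k)_*(ℒ), where ℒ is Lebesgue measure on [0,∞), f_k(t) = (θ_k, t) and g_k(t) = (θ_k + π, −t); set μ_ext = ν₀ + ν₁ + ν₂. Let H_r = {x ∈ ℝ² : Σ_{k=0}^{2} max(0, ⟨x, u_k⟩) ≤ 4r} be the ball of radius r > 0 of the pseudo-metric induced by μ_ext. Then area_{μ_ext}(H_r) = (6/π)·r². -/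

import Mathlib

noncomputable section

open MeasureTheory Real

instance : MeasurableSpace Real.Angle :=
  inferInstanceAs (MeasurableSpace (AddCircle (2 * π)))

/-- The space `Γ = (ℝ/2πℤ) × ℝ` parameterizing the lines of the Euclidean plane. -/
abbrev LineSpace : Type := Real.Angle × ℝ

/-- The line `ℓ(θ, p) = {z : z₁ sin θ − z₂ cos θ = p}` corresponding to `(θ, p) ∈ Γ`. -/
def lineOf (γ : LineSpace) : Set (ℝ × ℝ) :=
  {z : ℝ × ℝ | z.1 * γ.1.sin - z.2 * γ.1.cos = γ.2}

/-- `Γ_A`: the set of (parameters of) lines meeting a given subset `A` of the plane. -/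
def linesMeeting (A : Set (ℝ × ℝ)) : Set LineSpace :=
  {γ : LineSpace | (lineOf γ ∩ A).Nonempty}

/-- A Borel measure `μ` on the space of lines is *admissible* if it is invariant under
the involution `(θ, p) ↦ (θ + π, −p)` reversing orientations, is finite on compact sets,
and gives measure zero to the set of lines through any given point of the plane. -/
def Admissible (μ : Measure LineSpace) : Prop :=
  μ.map (fun γ : LineSpace => (γ.1 + ((π : ℝ) : Real.Angle), -γ.2)) = μ ∧
    (∀ K : Set LineSpace, IsCompact K → μ K < ⊤) ∧
    (∀ z : ℝ × ℝ, μ (linesMeeting {z}) = 0)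

/-- The pseudo-distance `d_μ(x, y) = (1/4)·μ(Γ_{[x,y]})` induced by a measure `μ` on the
space of lines. -/
def lineDist (μ : Measure LineSpace) (x y : ℝ × ℝ) : ℝ :=
  (μ (linesMeeting (segment ℝ x y))).toReal / 4

/-- The area `area_μ(A) = (1/(8π))·(μ ⊗ μ)({pairs of distinct lines meeting inside A})`
induced by a measure `μ` on the space of lines (the Santaló+Blaschke area). -/
def lineArea (μ : Measure LineSpace) (A : Set (ℝ × ℝ)) : ℝ :=
  ((μ.prod μ) {γ : LineSpace × LineSpace |
      lineOf γ.1 ≠ lineOf γ.2 ∧ (lineOf γ.1 ∩ lineOf γ.2 ∩ A).Nonempty}).toReal / (8 * π)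

/-- Weak convergence of a sequence of measures: convergence of the integrals of all
bounded continuous functions. -/
def WeakTendsto (μs : ℕ → Measure LineSpace) (μ : Measure LineSpace) : Prop :=
  ∀ f : BoundedContinuousFunction LineSpace ℝ,
    Filter.Tendsto (fun n => ∫ γ, f γ ∂(μs n)) Filter.atTop (nhds (∫ γ, f γ ∂μ))

open scoped ENNReal

/-- The unit vector `u_k = (sin θ_k, −cos θ_k)` with `θ_k = 2kπ/3`. -/
def uExt (k : ℕ) : ℝ × ℝ :=
  (Real.sin (2 * k * π / 3), -Real.cos (2 * k * π / 3))

/-- The standard inner product of `ℝ²`. -/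
def dot2 (x u : ℝ × ℝ) : ℝ := x.1 * u.1 + x.2 * u.2

/-- `f_k(t) = (θ_k, t)` where `θ_k = 2kπ/3`. -/
def fExt (k : ℕ) : ℝ → LineSpace := fun t => (((2 * k * π / 3 : ℝ) : Real.Angle), t)

/-- `g_k(t) = (θ_k + π, −t)` where `θ_k = 2kπ/3`. -/
def gExt (k : ℕ) : ℝ → LineSpace := fun t => (((2 * k * π / 3 + π : ℝ) : Real.Angle), -t)

/-- The measure `ν_k = (1/2)(f_k)_*(ℒ) + (1/2)(g_k)_*(ℒ)`, where `ℒ` is the Lebesgue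
measure on `[0, ∞)`. -/
def nuExt (k : ℕ) : Measure LineSpace :=
  (1 / 2 : ℝ≥0∞) • (volume.restrict (Set.Ici (0 : ℝ))).map (fExt k) +
    (1 / 2 : ℝ≥0∞) • (volume.restrict (Set.Ici (0 : ℝ))).map (gExt k)

/-- The extremal measure `μ_ext = ν₀ + ν₁ + ν₂`, concentrated on three pencils of
parallel lines. -/
def muExt : Measure LineSpace := nuExt 0 + nuExt 1 + nuExt 2

/-- The ball `H_r = {x ∈ ℝ² : ∑ₖ max(0, ⟨x, u_k⟩) ≤ 4r}` of radius `r` centered at the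
origin for the pseudo-metric induced by `μ_ext`. -/
def hexBall (r : ℝ) : Set (ℝ × ℝ) :=
  {x : ℝ × ℝ | ∑ k ∈ Finset.range 3, max 0 (dot2 x (uExt k)) ≤ 4 * r}

instance : BorelSpace Real.Angle :=
  inferInstanceAs (BorelSpace (AddCircle (2 * π)))

lemma measurableEmbedding_fExt (k : ℕ) : MeasurableEmbedding (fExt k) :=
  measurableEmbedding_prodMk_left _

lemma measurableEmbedding_gExt (k : ℕ) : MeasurableEmbedding (gExt k) :=
  MeasurableEmbedding.prodMk_left _ (MeasurableEquiv.neg ℝ).measurableEmbedding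

lemma lineOf_fExt (k : ℕ) (t : ℝ) : lineOf (fExt k t) = {z | dot2 z (uExt k) = t} := by
  ext z
  simp only [lineOf, fExt, dot2, uExt, Set.mem_ofPred_eq, Real.Angle.sin_coe, Real.Angle.cos_coe,
    mul_neg, sub_eq_add_neg]

lemma lineOf_gExt (k : ℕ) (t : ℝ) : lineOf (gExt k t) = {z | dot2 z (uExt k) = t} := by
  ext z
  simp only [lineOf, gExt, dot2, uExt, Set.mem_ofPred_eq, Real.Angle.sin_coe, Real.Angle.cos_coe,
    Real.sin_add_pi, Real.cos_add_pi]
  constructor <;> intro h <;> linarith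

lemma uExt_zero : uExt 0 = (0, -1) := by simp [uExt]

lemma uExt_one : uExt 1 = (√3 / 2, 1 / 2) := by
  have h : 2 * ((1 : ℕ) : ℝ) * π / 3 = π - π / 3 := by push_cast; ring
  simp [uExt, h, -Nat.cast_one, Real.sin_pi_sub, Real.cos_pi_sub]

lemma uExt_two : uExt 2 = (-(√3 / 2), 1 / 2) := by
  have h : 2 * ((2 : ℕ) : ℝ) * π / 3 = π / 3 + π := by push_cast; ring
  simp [uExt, h, -Nat.cast_ofNat, Real.sin_add_pi, Real.cos_add_pi]

/-- The pairs of distinct lines meeting inside `A`. -/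
def crossingPairs (A : Set (ℝ × ℝ)) : Set (LineSpace × LineSpace) :=
  {γ | lineOf γ.1 ≠ lineOf γ.2 ∧ (lineOf γ.1 ∩ lineOf γ.2 ∩ A).Nonempty}

/-- The signed offsets of the pairs of distinct lines, orthogonal to `u_j` and `u_k`
respectively, that meet inside `A`. -/
def crossingOffsets (A : Set (ℝ × ℝ)) (j k : ℕ) : Set (ℝ × ℝ) :=
  {p | {z | dot2 z (uExt j) = p.1} ≠ {z | dot2 z (uExt k) = p.2} ∧
    ({z | dot2 z (uExt j) = p.1} ∩ {z | dot2 z (uExt k) = p.2} ∩ A).Nonempty}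

lemma crossingOffsets_self (A : Set (ℝ × ℝ)) (k : ℕ) : crossingOffsets A k k = ∅ := by
  refine Set.eq_empty_of_forall_notMem ?_
  rintro ⟨s, t⟩ ⟨hne, z, ⟨hs, ht⟩, -⟩
  simp only [Set.mem_ofPred_eq] at hs ht
  exact hne (by simp [← hs, ← ht])

lemma dot2_uExt_self (k : ℕ) : dot2 (uExt k) (uExt k) = 1 := by
  simp only [dot2, uExt]
  linarith [Real.sin_sq_add_cos_sq (2 * k * π / 3)]

lemma dot2_uExt_of_ne {j k : ℕ} (hj : j < 3) (hk : k < 3) (hjk : j ≠ k) :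
    dot2 (uExt j) (uExt k) = -1 / 2 := by
  have h3 : √3 * √3 = 3 := Real.mul_self_sqrt (by norm_num)
  interval_cases j <;> interval_cases k <;> first
    | exact absurd rfl hjk
    | (simp only [dot2, uExt_zero, uExt_one, uExt_two]; linarith)

lemma mem_hexBall_iff {j k : ℕ} (hj : j < 3) (hk : k < 3) (hjk : j ≠ k) (r : ℝ) (z : ℝ × ℝ) :
    z ∈ hexBall r ↔ max 0 (dot2 z (uExt j)) + max 0 (dot2 z (uExt k)) +
      max 0 (-(dot2 z (uExt j) + dot2 z (uExt k))) ≤ 4 * r := by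
  have h : dot2 z (uExt 0) + dot2 z (uExt 1) + dot2 z (uExt 2) = 0 := by
    simp only [dot2, uExt_zero, uExt_one, uExt_two]
    ring
  simp only [hexBall, Set.mem_ofPred_eq, Finset.sum_range_succ, Finset.sum_range_zero, zero_add]
  interval_cases j <;> interval_cases k <;> first
    | exact absurd rfl hjk
    | grind

lemma crossingOffsets_hexBall {j k : ℕ} (hj : j < 3) (hk : k < 3) (hjk : j ≠ k) (r : ℝ)
    {s t : ℝ} (hs : 0 ≤ s) (ht : 0 ≤ t) :
    (s, t) ∈ crossingOffsets (hexBall r) j k ↔ s + t ≤ 4 * r := by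
  have hjj := dot2_uExt_self j
  have hkk := dot2_uExt_self k
  have hjk' := dot2_uExt_of_ne hj hk hjk
  constructor
  · rintro ⟨-, z, ⟨hzs, hzt⟩, hz⟩
    simp only [Set.mem_ofPred_eq] at hzs hzt
    rw [mem_hexBall_iff hj hk hjk, hzs, hzt, max_eq_right hs, max_eq_right ht] at hz
    linarith [le_max_left 0 (-(s + t))]
  · intro hst
    have solve (a b : ℝ) : ∃ z, dot2 z (uExt j) = a ∧ dot2 z (uExt k) = b := by
      refine ⟨(4 / 3 * (a + b / 2)) • uExt j + (4 / 3 * (b + a / 2)) • uExt k, ?_, ?_⟩ <;>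
        simp only [dot2, Prod.fst_add, Prod.snd_add, Prod.smul_fst, Prod.smul_snd,
          smul_eq_mul] at hjj hkk hjk' ⊢
      · linear_combination (4 / 3 * (a + b / 2)) * hjj + (4 / 3 * (b + a / 2)) * hjk'
      · linear_combination (4 / 3 * (a + b / 2)) * hjk' + (4 / 3 * (b + a / 2)) * hkk
    refine ⟨fun heq => ?_, ?_⟩
    · obtain ⟨w, hw, hw'⟩ := solve s (t + 1)
      have : w ∈ {z | dot2 z (uExt k) = t} := heq ▸ hw
      simp only [Set.mem_ofPred_eq] at this
      linarith
    · obtain ⟨z, hzs, hzt⟩ := solve s t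
      refine ⟨z, ⟨hzs, hzt⟩, ?_⟩
      rw [mem_hexBall_iff hj hk hjk, hzs, hzt, max_eq_right hs, max_eq_right ht,
        max_eq_left (by linarith)]
      linarith

/-- The area of the right isosceles triangle with legs `c` on the coordinate axes. -/
lemma volume_restrict_Ici_prod_triangle {c : ℝ} (hc : 0 ≤ c) :
    ((volume.restrict (Set.Ici (0 : ℝ))).prod (volume.restrict (Set.Ici (0 : ℝ))))
      {p : ℝ × ℝ | p.1 + p.2 ≤ c} = ENNReal.ofReal (c ^ 2 / 2) := by
  have hm : MeasurableSet {p : ℝ × ℝ | p.1 + p.2 ≤ c} :=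
    measurableSet_le (by fun_prop) (by fun_prop)
  have hslice (s : ℝ) : volume.restrict (Set.Ici (0 : ℝ))
      (Prod.mk s ⁻¹' {p : ℝ × ℝ | p.1 + p.2 ≤ c}) = ENNReal.ofReal (c - s) := by
    rw [Measure.restrict_apply (measurable_prodMk_left hm)]
    have : Prod.mk s ⁻¹' {p : ℝ × ℝ | p.1 + p.2 ≤ c} ∩ Set.Ici 0 = Set.Icc 0 (c - s) := by
      ext t
      simp only [Set.mem_inter_iff, Set.mem_preimage, Set.mem_ofPred_eq, Set.mem_Ici, Set.mem_Icc]
      constructor <;> rintro ⟨h, h'⟩ <;> constructor <;> linarith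
    rw [this, Real.volume_Icc, sub_zero]
  rw [Measure.prod_apply hm]
  simp_rw [hslice]
  have hzero : ∫⁻ s in Set.Ioi c, ENNReal.ofReal (c - s) = 0 := by
    rw [setLIntegral_congr_fun measurableSet_Ioi (g := fun _ => 0)
      (fun s hs => ENNReal.ofReal_of_nonpos (sub_nonpos.2 (le_of_lt hs))), lintegral_zero]
  rw [← Set.Icc_union_Ioi_eq_Ici hc, lintegral_union measurableSet_Ioi
    (Set.disjoint_left.2 fun x hx hx' => not_lt.2 hx.2 hx'), hzero, add_zero,
    ← ofReal_integral_eq_lintegral_ofReal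
      ((by fun_prop : Continuous fun s : ℝ => c - s).integrableOn_Icc)
      ((ae_restrict_iff' measurableSet_Icc).2 (.of_forall fun s hs => sub_nonneg.2 hs.2)),
    integral_Icc_eq_integral_Ioc, ← intervalIntegral.integral_of_le hc]
  congr 1
  rw [intervalIntegral.integral_sub (by simp) (by simp)]
  simp
  ring

instance (k : ℕ) : SFinite (nuExt k) := by
  unfold nuExt
  infer_instance

lemma map_prod_map_crossingPairs {a b : ℝ → LineSpace} {j k : ℕ}
    (ha : MeasurableEmbedding a) (hb : MeasurableEmbedding b)
    (haj : ∀ t, lineOf (a t) = {z | dot2 z (uExt j) = t})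
    (hbk : ∀ t, lineOf (b t) = {z | dot2 z (uExt k) = t})
    (m : Measure ℝ) [SFinite m] (A : Set (ℝ × ℝ)) :
    (m.map a).prod (m.map b) (crossingPairs A) = (m.prod m) (crossingOffsets A j k) := by
  rw [Measure.map_prod_map _ _ ha.measurable hb.measurable, (ha.prodMap hb).map_apply]
  simp only [crossingPairs, crossingOffsets, Set.preimage_ofPred_eq, Prod.map_fst, Prod.map_snd,
    haj, hbk]

lemma nuExt_prod_nuExt_crossingPairs (j k : ℕ) (A : Set (ℝ × ℝ)) :
    (nuExt j).prod (nuExt k) (crossingPairs A) =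
      ((volume.restrict (Set.Ici (0 : ℝ))).prod (volume.restrict (Set.Ici (0 : ℝ))))
        (crossingOffsets A j k) := by
  have hf := measurableEmbedding_fExt
  have hg := measurableEmbedding_gExt
  simp only [nuExt, Measure.add_prod, Measure.prod_add, Measure.prod_smul_left,
    Measure.prod_smul_right, Measure.add_apply, Measure.smul_apply, smul_eq_mul,
    map_prod_map_crossingPairs (hf j) (hf k) (lineOf_fExt j) (lineOf_fExt k),
    map_prod_map_crossingPairs (hf j) (hg k) (lineOf_fExt j) (lineOf_gExt k),
    map_prod_map_crossingPairs (hg j) (hf k) (lineOf_gExt j) (lineOf_fExt k),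
    map_prod_map_crossingPairs (hg j) (hg k) (lineOf_gExt j) (lineOf_gExt k),
    one_div, ← two_mul, ← mul_assoc]
  simp [ENNReal.mul_inv_cancel]

lemma nuExt_prod_self_crossingPairs (k : ℕ) (A : Set (ℝ × ℝ)) :
    (nuExt k).prod (nuExt k) (crossingPairs A) = 0 := by
  rw [nuExt_prod_nuExt_crossingPairs, crossingOffsets_self, measure_empty]

lemma nuExt_prod_nuExt_crossingPairs_hexBall {j k : ℕ} (hj : j < 3) (hk : k < 3) (hjk : j ≠ k)
    {r : ℝ} (hr : 0 ≤ r) :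
    (nuExt j).prod (nuExt k) (crossingPairs (hexBall r)) = ENNReal.ofReal (8 * r ^ 2) := by
  have hc := volume_restrict_Ici_prod_triangle (c := 4 * r) (by positivity)
  rw [nuExt_prod_nuExt_crossingPairs, show 8 * r ^ 2 = (4 * r) ^ 2 / 2 by ring, ← hc]
  refine measure_congr ?_
  rw [Measure.prod_restrict]
  filter_upwards [ae_restrict_mem (measurableSet_Ici.prod measurableSet_Ici)] with p hp
  exact propext (crossingOffsets_hexBall hj hk hjk r hp.1 hp.2)

/-- **The extremal pseudo-metric disk has area `(6/π)·r²`** (Section 11 of the paper):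
the ball `H_r` of radius `r` of the pseudo-metric induced by `μ_ext` has
Santaló+Blaschke area exactly `(6/π)·r²`. -/
theorem lineArea_muExt_hexBall (r : ℝ) (hr : 0 < r) :
    lineArea muExt (hexBall r) = (6 / π) * r ^ 2 := by
  have h := fun j k (hj : j < 3) (hk : k < 3) (hjk : j ≠ k) =>
    nuExt_prod_nuExt_crossingPairs_hexBall hj hk hjk hr.le
  change ((muExt.prod muExt) (crossingPairs (hexBall r))).toReal / (8 * π) = _
  simp only [muExt, Measure.add_prod, Measure.prod_add, Measure.add_apply,
    nuExt_prod_self_crossingPairs, h 0 1, h 0 2, h 1 0, h 1 2, h 2 0, h 2 1, Nat.ofNat_pos,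
    Nat.one_lt_ofNat, Nat.lt_add_one, ne_eq, zero_ne_one, one_ne_zero, OfNat.ofNat_ne_zero,
    OfNat.zero_ne_ofNat, OfNat.one_ne_ofNat, OfNat.ofNat_ne_one, not_false_eq_true,
    add_zero, zero_add]
  have h8 : 0 ≤ 8 * r ^ 2 := by positivity
  simp only [ENNReal.toReal_add, ENNReal.toReal_ofReal h8, ne_eq, ENNReal.add_eq_top,
    ENNReal.ofReal_ne_top, or_self, not_false_eq_true]
  field_simp
  norm_num
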